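/- arXiv:1903.07524 — 3 statements merged into one kernel-verified Lean document; each statement's English description precedes it below -/
import Mathlib

section
/- Let A be an arc in K with endpoints x̄ and ȳ such that A contains no folding point of K. Let V be a neighborhood of A in K and m ∈ ℕ be such that V is homeomorphic to C × [0,1] for some compact zero-dimensional set C (with the boundary of V corresponding to C × {0,1}) and π_m restricted to every arc contained in V is injective. Let (A_n)_{n∈ℕ} be arcs in K with endpoints x̄_n and ȳ_n such that x̄_n → x̄ and ȳ_n → ȳ, and suppose there is N ∈ ℕ such that A_n ∩ E_m = ∅ for all n ≥ N. Then A_n converges to A in the Hausdorff metric. -/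
open Set Filter Topology Function

noncomputable section

/-- The tent map with slope `s`. -/
def tent (s : ℝ) (x : ℝ) : ℝ := min (s * x) (s * (1 - x))

/-- The ω-limit set of `c` under iteration of `f`. -/
def omegaSet (f : ℝ → ℝ) (c : ℝ) : Set ℝ :=
  {y | ∃ φ : ℕ → ℕ, StrictMono φ ∧ Tendsto (fun k => f^[φ k] c) atTop (𝓝 y)}

/-- The inverse limit space `K = lim←([0,1], T)`, as a subset of `ℕ → ℝ`. -/
def invLim (s : ℝ) : Set (ℕ → ℝ) :=
  {x | (∀ n, x n ∈ Icc (0 : ℝ) 1) ∧ ∀ n, x n = tent s (x (n + 1))}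

/-- The `n`-th coordinate projection `π_n : K → [0,1]`. -/
def proj (s : ℝ) (n : ℕ) (x : invLim s) : ℝ := (x : ℕ → ℝ) n

/-- The inverse shift homeomorphism `σ̂⁻¹(x₀,x₁,…) = (x₁,x₂,…)` as a map `K → K`. -/
def shiftInvFun (s : ℝ) (x : invLim s) : invLim s :=
  ⟨fun n => (x : ℕ → ℝ) (n + 1), fun n => x.2.1 (n + 1), fun n => x.2.2 (n + 1)⟩

/-- The shift homeomorphism `σ̂(x₀,x₁,…) = (T x₀, x₀, x₁, …)` as a map `K → K`. -/
def shiftFwdFun (s : ℝ) (hs1 : Real.sqrt 2 < s) (hs2 : s < 2) (x : invLim s) : invLim s := by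
  refine ⟨fun n => Nat.casesOn n (tent s ((x : ℕ → ℝ) 0)) (fun k => (x : ℕ → ℝ) k), ?_, ?_⟩
  · intro n
    cases n with
    | zero =>
      have hx0 := x.2.1 0
      have hs0 : 0 ≤ s := le_of_lt (lt_of_le_of_lt (Real.sqrt_nonneg 2) hs1)
      constructor
      · exact le_min (mul_nonneg hs0 hx0.1) (mul_nonneg hs0 (by linarith [hx0.2]))
      · rcases le_total ((x : ℕ → ℝ) 0) (1 / 2) with hc | hc
        · exact le_trans (min_le_left _ _) (by nlinarith [hx0.1, hx0.2])
        · exact le_trans (min_le_right _ _) (by nlinarith [hx0.1, hx0.2])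
    | succ k => exact x.2.1 k
  · intro n
    cases n with
    | zero => rfl
    | succ k => exact x.2.2 k

/-- The integer power `σ̂^b` of the shift homeomorphism : for `b ≥ 0` it is the `b`-th iterate
of `σ̂`, and for `b < 0` the `|b|`-th iterate of `σ̂⁻¹`. -/
def shiftZ (s : ℝ) (hs1 : Real.sqrt 2 < s) (hs2 : s < 2) (b : ℤ) : invLim s → invLim s :=
  if 0 ≤ b then (shiftFwdFun s hs1 hs2)^[b.toNat] else (shiftInvFun s)^[(-b).toNat]

/-- The set `F` of folding points of `K`. -/
def foldingPts (s : ℝ) : Set (invLim s) :=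
  {x | ∀ n, proj s n x ∈ omegaSet (tent s) (1 / 2)}

/-- The set `E_p` of `p`-points of `K`. -/
def pPoints (s : ℝ) (p : ℕ) : Set (invLim s) :=
  {x | ∃ n, p < n ∧ proj s n x = 1 / 2}

/-- `A` is an arc with endpoints `a` and `b`. -/
def IsArcWith {X : Type*} [TopologicalSpace X] (A : Set X) (a b : X) : Prop :=
  ∃ f : unitInterval → X, Topology.IsEmbedding f ∧ range f = A ∧ f 0 = a ∧ f 1 = b

/-- `A` is an arc (a homeomorphic copy of `[0,1]`). -/
def IsArc {X : Type*} [TopologicalSpace X] (A : Set X) : Prop :=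
  ∃ a b, IsArcWith A a b

/-- `A` is an arc with endpoints `a`, `b`, possibly degenerate (a single point when `a = b`). -/
def IsArcBtw {X : Type*} [TopologicalSpace X] (A : Set X) (a b : X) : Prop :=
  IsArcWith A a b ∨ (a = b ∧ A = {a})

/-- `A` is an arc, possibly degenerate (i.e. a single point). -/
def IsArcOrPoint {X : Type*} [TopologicalSpace X] (A : Set X) : Prop :=
  IsArc A ∨ ∃ x, A = {x}

/-- The composant of a point `x`: the union of all proper subcontinua containing `x`. -/
def composant {X : Type*} [TopologicalSpace X] (x : X) : Set X :=
  {y | ∃ A : Set X, IsCompact A ∧ IsConnected A ∧ A ≠ univ ∧ x ∈ A ∧ y ∈ A}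

/-- `g` preserves the order along composants: for every composant `C` and every continuous
bijection `φ` from `ℝ` (respectively from `[0,∞)`) onto `C`, the map `φ⁻¹ ∘ g ∘ φ` is strictly
increasing. -/
def PreservesCompOrder {X : Type*} [TopologicalSpace X] (g : X → X) : Prop :=
  ∀ x : X,
    (∀ φ : ℝ → X, Continuous φ → Injective φ → range φ = composant x →
      ∀ t t' u u' : ℝ, g (φ t) = φ u → g (φ t') = φ u' → t < t' → u < u') ∧
    (∀ φ : {r : ℝ // (0 : ℝ) ≤ r} → X, Continuous φ → Injective φ → range φ = composant x →
      ∀ t t' u u', g (φ t) = φ u → g (φ t') = φ u' → t < t' → u < u')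

/-- Two self-maps of `X` are isotopic if there is a continuous `H : X × [0,1] → X` joining them
through homeomorphisms. -/
def Isotopic {X : Type*} [TopologicalSpace X] (f g : X → X) : Prop :=
  ∃ H : X × unitInterval → X, Continuous H ∧ (∀ x, H (x, 0) = f x) ∧ (∀ x, H (x, 1) = g x) ∧
    ∀ t : unitInterval, IsHomeomorph fun x => H (x, t)

/-- The topological limsup of a sequence of subsets. -/
def setLimsup {X : Type*} [TopologicalSpace X] (D : ℕ → Set X) : Set X :=
  {y | ∃ φ : ℕ → ℕ, StrictMono φ ∧ ∃ z : ℕ → X, (∀ k, z k ∈ D (φ k)) ∧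
    Tendsto z atTop (𝓝 y)}

/-- The point `0̄ = (0,0,0,…)` of `K` (an endpoint of `K`). -/
def zeroPt (s : ℝ) (hs1 : Real.sqrt 2 < s) : invLim s := by
  refine ⟨fun _ => 0, fun n => ⟨le_refl 0, zero_le_one⟩, fun n => ?_⟩
  have hs0 : 0 ≤ s := le_of_lt (lt_of_le_of_lt (Real.sqrt_nonneg 2) hs1)
  simp [tent]
  exact hs0

theorem invLim_ext_ge {s : ℝ} (m : ℕ) (z w : invLim s)
    (h : ∀ k, m ≤ k → (z : ℕ → ℝ) k = (w : ℕ → ℝ) k) : z = w := by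
  have key : ∀ j k, m ≤ k + j → (z : ℕ → ℝ) k = (w : ℕ → ℝ) k := by
    intro j
    induction j with
    | zero => intro k hk; exact h k (by omega)
    | succ j ih =>
      intro k hk
      rw [z.2.2 k, w.2.2 k, ih (k + 1) (by omega)]
  apply Subtype.ext
  funext k
  exact key m k (by omega)

theorem tent_eq {s u v : ℝ} (hs : 0 < s) (h : tent s u = tent s v) : u = v ∨ u + v = 1 := by
  have hs' : s ≠ 0 := hs.ne'
  unfold tent at h
  have e : ∀ x : ℝ, min (s * x) (s * (1 - x)) = s * min x (1 - x) := fun x =>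
    (mul_min_of_nonneg _ _ hs.le).symm
  rw [e, e] at h
  have h2 := mul_left_cancel₀ hs' h
  rcases min_choice u (1 - u) with h3 | h3 <;> rcases min_choice v (1 - v) with h4 | h4 <;>
    rw [h3, h4] at h2
  · left; linarith
  · right; linarith
  · right; linarith
  · left; linarith

theorem invLim_compact (s : ℝ) : CompactSpace (invLim s) := by
  rw [← isCompact_iff_compactSpace]
  have h1 : IsCompact (Set.pi univ (fun _ : ℕ => Icc (0 : ℝ) 1)) :=
    isCompact_univ_pi (fun _ => isCompact_Icc)
  refine h1.of_isClosed_subset ?_ ?_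
  · have : invLim s = (⋂ n, {x : ℕ → ℝ | x n ∈ Icc (0 : ℝ) 1}) ∩
        ⋂ n, {x : ℕ → ℝ | x n = tent s (x (n + 1))} := by
      ext x; simp [invLim]
    rw [this]
    refine IsClosed.inter (isClosed_iInter fun n => ?_) (isClosed_iInter fun n => ?_)
    · exact isClosed_Icc.preimage (continuous_apply n)
    · refine isClosed_eq (continuous_apply n) ?_
      unfold tent
      fun_prop
  · intro x hx n _
    exact hx.1 n

theorem proj_cont (s : ℝ) (k : ℕ) : Continuous (proj s k) :=
  (continuous_apply k).comp continuous_subtype_val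

/-- An arc without `m`-points is mapped injectively by `π_m`. -/
theorem injOn_of_no_pPoints {s : ℝ} (hs : 0 < s) (m : ℕ) (B : Set (invLim s)) (hB : IsPreconnected B)
    (h : B ∩ pPoints s m = ∅) : InjOn (proj s m) B := by
  intro z hz w hw hzw
  apply invLim_ext_ge m
  intro k hk
  induction k, hk using Nat.le_induction with
  | base => exact hzw
  | succ k hk ih =>
    rw [z.2.2 k, w.2.2 k] at ih
    rcases tent_eq hs ih with h1 | h1
    · exact h1
    · exfalso
      have hc : IsPreconnected (proj s (k + 1) '' B) :=
        hB.image _ (proj_cont s _).continuousOn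
      have ho := hc.ordConnected
      have h2 : (1 / 2 : ℝ) ∈ uIcc (proj s (k + 1) z) (proj s (k + 1) w) := by
        rw [mem_uIcc]
        have h1' : proj s (k + 1) z + proj s (k + 1) w = 1 := h1
        rcases le_total (proj s (k + 1) z) (1 / 2) with h3 | h3
        · left; constructor <;> linarith
        · right; constructor <;> linarith
      obtain ⟨p, hp, hp2⟩ := ho.uIcc_subset (mem_image_of_mem _ hz) (mem_image_of_mem _ hw) h2
      have : p ∈ B ∩ pPoints s m := ⟨hp, k + 1, by omega, hp2⟩
      rw [h] at this
      exact this

/-- Injective continuous real function on the unit interval has image the segment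
between the endpoint values. -/
theorem mem_uIcc_of_inj (g : unitInterval → ℝ) (hg : Continuous g) (hi : Injective g)
    (t : unitInterval) : g t ∈ uIcc (g 0) (g 1) := by
  rcases hg.strictMono_of_inj hi with h | h
  · rw [mem_uIcc]; left
    exact ⟨h.monotone t.2.1, h.monotone t.2.2⟩
  · rw [mem_uIcc]; right
    exact ⟨h.antitone t.2.2, h.antitone t.2.1⟩

theorem uIcc_subset_range (g : unitInterval → ℝ) (hg : Continuous g) :
    uIcc (g 0) (g 1) ⊆ range g :=
  (isPreconnected_range hg).ordConnected.uIcc_subset (mem_range_self _) (mem_range_self _)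

theorem exists_param {a b z : ℝ} (h : z ∈ uIcc a b) : ∃ t : unitInterval, z = a + t * (b - a) := by
  rw [← segment_eq_uIcc, segment_eq_image'] at h
  obtain ⟨t, ht, rfl⟩ := h
  exact ⟨⟨t, ht⟩, by simp⟩

theorem param_mem (a b : ℝ) (t : unitInterval) : a + t * (b - a) ∈ uIcc a b := by
  rw [← segment_eq_uIcc, segment_eq_image']
  exact ⟨t, t.2, by simp⟩

theorem tent_affine {s a b : ℝ} (hi : InjOn (tent s) (uIcc a b)) (t : unitInterval) :
    tent s (a + t * (b - a)) = tent s a + t * (tent s b - tent s a) := by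
  have ht0 := t.2.1
  have ht1 := t.2.2
  have hside : (a ≤ 1 / 2 ∧ b ≤ 1 / 2) ∨ (1 / 2 ≤ a ∧ 1 / 2 ≤ b) := by
    by_contra hcon
    have key : ∀ u v : ℝ, u < 1 / 2 → 1 / 2 < v → InjOn (tent s) (Icc u v) → False := by
      intro u v hu hv hinj
      set d := min (1 / 2 - u) (v - 1 / 2) with hd
      have hd0 : 0 < d := lt_min (by linarith) (by linarith)
      have h1 : d ≤ 1 / 2 - u := min_le_left _ _
      have h2 : d ≤ v - 1 / 2 := min_le_right _ _
      have e : tent s (1 / 2 - d) = tent s (1 / 2 + d) := by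
        unfold tent
        rw [min_comm]
        congr 1 <;> ring
      have hu1 : (1 / 2 - d) ∈ Icc u v := ⟨by linarith, by linarith⟩
      have hv1 : (1 / 2 + d) ∈ Icc u v := ⟨by linarith, by linarith⟩
      have := hinj hu1 hv1 e
      linarith
    rcases lt_or_ge a (1 / 2) with h1 | h1 <;> rcases lt_or_ge (1 / 2) b with h2 | h2
    · exact key a b h1 h2 (hi.mono Icc_subset_uIcc)
    · exact hcon (Or.inl ⟨h1.le, h2⟩)
    · exact hcon (Or.inr ⟨h1, h2.le⟩)
    · rcases h1.eq_or_lt with h3 | h3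
      · exact hcon (Or.inl ⟨h3.symm.le, h2⟩)
      · rcases h2.eq_or_lt with h4 | h4
        · exact hcon (Or.inr ⟨h1, h4.symm.le⟩)
        · exact key b a h4 h3 (hi.mono Icc_subset_uIcc')
  have hm := param_mem a b t
  by_cases hs : 0 ≤ s
  all_goals
    have hl : ∀ x : ℝ, x ≤ 1 / 2 → tent s x = if 0 ≤ s then s * x else s * (1 - x) := by
      intro x hx
      unfold tent
      split_ifs
      first
        | (apply min_eq_left; nlinarith)
        | (apply min_eq_right; nlinarith)
    have hr : ∀ x : ℝ, 1 / 2 ≤ x → tent s x = if 0 ≤ s then s * (1 - x) else s * x := by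
      intro x hx
      unfold tent
      split_ifs
      first
        | (apply min_eq_left; nlinarith)
        | (apply min_eq_right; nlinarith)
    rw [mem_uIcc] at hm
    rcases hside with ⟨h1, h2⟩ | ⟨h1, h2⟩
    · rw [hl a h1, hl b h2, hl _ (by rcases hm with hm | hm <;> linarith [hm.2])]
      simp only [hs, if_true, if_false]
      ring
    · rw [hr a h1, hr b h2, hr _ (by rcases hm with hm | hm <;> linarith [hm.1])]
      simp only [hs, if_true, if_false]
      ring

/-- An arc on which `π_m` is injective is the straight segment in all coordinates `≥ m`. -/
theorem arc_param {s : ℝ} (m : ℕ) (B : Set (invLim s)) (a b : invLim s)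
    (hB : IsArcWith B a b) (hi : InjOn (proj s m) B) :
    ∃ Φ : unitInterval → invLim s, B = range Φ ∧
      ∀ t k, m ≤ k → proj s k (Φ t) = proj s k a + t * (proj s k b - proj s k a) := by
  obtain ⟨f, hf, rfl, rfl, rfl⟩ := hB
  -- every later projection is injective
  have hproj : ∀ k, ∀ z w : invLim s, proj s (k + 1) z = proj s (k + 1) w →
      proj s k z = proj s k w := by
    intro k z w h
    have h' : (z : ℕ → ℝ) (k + 1) = (w : ℕ → ℝ) (k + 1) := h
    change (z : ℕ → ℝ) k = (w : ℕ → ℝ) k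
    rw [z.2.2 k, w.2.2 k, h']
  have hinj : ∀ k, m ≤ k → Injective (fun t => proj s k (f t)) := by
    intro k hk
    induction k, hk using Nat.le_induction with
    | base =>
      intro t u htu
      exact hf.injective (hi (mem_range_self _) (mem_range_self _) htu)
    | succ k hk ih =>
      intro t u htu
      exact ih (hproj k _ _ htu)
  have hcont : ∀ k, Continuous (fun t => proj s k (f t)) := fun k =>
    (proj_cont s k).comp hf.continuous
  have hT : ∀ k (z : invLim s), proj s k z = tent s (proj s (k + 1) z) := fun k z => z.2.2 k
  have htinj : ∀ k, m ≤ k → InjOn (tent s) (uIcc (proj s (k + 1) (f 0)) (proj s (k + 1) (f 1))) := by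
    intro k hk u hu v hv huv
    obtain ⟨t, rfl⟩ := uIcc_subset_range _ (hcont (k + 1)) hu
    obtain ⟨t', rfl⟩ := uIcc_subset_range _ (hcont (k + 1)) hv
    have : t = t' := by
      apply hinj k hk
      change proj s k (f t) = proj s k (f t')
      rw [hT k (f t), hT k (f t')]; exact huv
    rw [this]
  have hall : ∀ τ t : unitInterval,
      proj s m (f τ) = proj s m (f 0) + t * (proj s m (f 1) - proj s m (f 0)) →
      ∀ k, m ≤ k → proj s k (f τ) = proj s k (f 0) + t * (proj s k (f 1) - proj s k (f 0)) := by
    intro τ t h0 k hk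
    induction k, hk using Nat.le_induction with
    | base => exact h0
    | succ k hk ih =>
      obtain ⟨t', ht'⟩ := exists_param (mem_uIcc_of_inj _ (hcont (k + 1)) (hinj (k + 1) (by omega)) τ)
      have h1 := tent_affine (htinj k hk) t'
      rw [← ht', ← hT, ← hT, ← hT, ih] at h1
      have hne : proj s k (f 1) - proj s k (f 0) ≠ 0 := by
        rw [sub_ne_zero]
        intro h
        have := hinj k hk h
        simp at this
      have h2 : (t : ℝ) = t' := mul_right_cancel₀ hne (by linarith)
      rw [h2]; exact ht'
  have hex : ∀ t : unitInterval, ∃ τ, proj s m (f τ) =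
      proj s m (f 0) + t * (proj s m (f 1) - proj s m (f 0)) := by
    intro t
    exact uIcc_subset_range _ (hcont m) (param_mem _ _ t)
  choose τ hτ using hex
  refine ⟨fun t => f (τ t), ?_, fun t k hk => hall (τ t) t (hτ t) k hk⟩
  apply Subset.antisymm
  · rintro _ ⟨u, rfl⟩
    obtain ⟨t, ht⟩ := exists_param (mem_uIcc_of_inj _ (hcont m) (hinj m le_rfl) u)
    refine ⟨t, ?_⟩
    change f (τ t) = f u
    congr 1
    apply hinj m le_rfl
    change proj s m (f (τ t)) = proj s m (f u)
    rw [hτ t]; exact ht.symm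
  · rintro _ ⟨t, rfl⟩
    exact mem_range_self _

theorem hausdorff_aux {X : Type*} [MetricSpace X] (An : ℕ → Set X) (A : Set X)
    (Φ : ℕ → unitInterval → X) (Ψ : unitInterval → X) (N : ℕ)
    (hAn : ∀ n, N ≤ n → An n = range (Φ n)) (hA : A = range Ψ)
    (h : ∀ g : Ultrafilter (ℕ × unitInterval), (g : Filter (ℕ × unitInterval)) ≤ atTop ×ˢ ⊤ →
      ∃ p, Tendsto (fun q : ℕ × unitInterval => Φ q.1 q.2) g (𝓝 p) ∧
        Tendsto (fun q : ℕ × unitInterval => Ψ q.2) g (𝓝 p)) :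
    Tendsto (fun n => Metric.hausdorffDist (An n) A) atTop (𝓝 0) := by
  have h1 : Tendsto (fun q : ℕ × unitInterval => dist (Φ q.1 q.2) (Ψ q.2)) (atTop ×ˢ ⊤) (𝓝 0) := by
    rw [tendsto_iff_ultrafilter]
    intro g hg
    obtain ⟨p, hp1, hp2⟩ := h g hg
    have := hp1.dist hp2
    rwa [dist_self] at this
  rw [Metric.tendsto_atTop]
  intro ε hε
  have h2 := h1.eventually (gt_mem_nhds (half_pos hε))
  rw [← principal_univ, eventually_prod_principal_iff] at h2
  obtain ⟨M, hM⟩ := eventually_atTop.1 h2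
  refine ⟨max M N, fun n hn => ?_⟩
  have h3 := hM n (le_trans (le_max_left _ _) hn)
  rw [Real.dist_eq, sub_zero, abs_of_nonneg Metric.hausdorffDist_nonneg,
    hAn n (le_trans (le_max_right _ _) hn), hA]
  refine lt_of_le_of_lt (Metric.hausdorffDist_le_of_mem_dist (half_pos hε).le ?_ ?_) (half_lt_self hε)
  · rintro _ ⟨t, rfl⟩
    exact ⟨Ψ t, mem_range_self _, (h3 t (mem_univ _)).le⟩
  · rintro _ ⟨t, rfl⟩
    exact ⟨Φ n t, mem_range_self _, by rw [dist_comm]; exact (h3 t (mem_univ _)).le⟩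

/-- if `A` is an arc avoiding folding points, `V, m` are as in Lemma 5.1, and the
arcs `A_n` have endpoints converging to those of `A` and eventually contain no `m`-points, then
`A_n → A` in the Hausdorff metric. -/
theorem statement7 (s : ℝ) (hs1 : Real.sqrt 2 < s) (hs2 : s < 2)
    (hnr : (1 : ℝ) / 2 ∉ omegaSet (tent s) (1 / 2))
    (A : Set (invLim s)) (x y : invLim s) (hA : IsArcWith A x y)
    (hAF : ∀ z ∈ A, z ∉ foldingPts s)
    (V : Set (invLim s)) (hV : A ⊆ interior V)
    (C : Type) [TopologicalSpace C] [CompactSpace C] [TotallyDisconnectedSpace C]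
    (e : C × unitInterval ≃ₜ V)
    (hbd : (fun p => (e p : invLim s)) '' (univ ×ˢ ({0, 1} : Set unitInterval)) = frontier V)
    (m : ℕ) (hm : ∀ B : Set (invLim s), B ⊆ V → IsArc B → InjOn (proj s m) B)
    (An : ℕ → Set (invLim s)) (xn yn : ℕ → invLim s)
    (hAn : ∀ n, IsArcWith (An n) (xn n) (yn n))
    (hxn : Tendsto xn atTop (𝓝 x)) (hyn : Tendsto yn atTop (𝓝 y))
    (N : ℕ) (hE : ∀ n, N ≤ n → An n ∩ pPoints s m = ∅) :
    letI : MetricSpace (invLim s) := TopologicalSpace.metrizableSpaceMetric _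
    Tendsto (fun n => Metric.hausdorffDist (An n) A) atTop (𝓝 0) := by
  have hs : 0 < s := lt_of_le_of_lt (Real.sqrt_nonneg 2) hs1
  haveI := invLim_compact s
  obtain ⟨Ψ, hΨ, hΨ2⟩ := arc_param m A x y hA
    (hm A (hV.trans interior_subset) ⟨x, y, hA⟩)
  have hn : ∀ n, ∃ Φ : unitInterval → invLim s, N ≤ n → (An n = range Φ ∧
      ∀ t k, m ≤ k → proj s k (Φ t) =
        proj s k (xn n) + t * (proj s k (yn n) - proj s k (xn n))) := by
    intro n
    by_cases hN : N ≤ n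
    · have hpc : IsPreconnected (An n) := by
        obtain ⟨f, hf, hr, -, -⟩ := hAn n
        rw [← hr]
        exact isPreconnected_range hf.continuous
      obtain ⟨Φ, hΦ⟩ := arc_param m (An n) _ _ (hAn n)
        (injOn_of_no_pPoints hs m _ hpc (hE n hN))
      exact ⟨Φ, fun _ => hΦ⟩
    · exact ⟨Ψ, fun h => absurd h hN⟩
  choose Φ hΦ using hn
  have key : ∀ g : Ultrafilter (ℕ × unitInterval), (g : Filter (ℕ × unitInterval)) ≤ atTop ×ˢ ⊤ →
      ∃ p, Tendsto (fun q : ℕ × unitInterval => Φ q.1 q.2) g (𝓝 p) ∧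
        Tendsto (fun q : ℕ × unitInterval => Ψ q.2) g (𝓝 p) := by
    intro g hg
    have hlim : ∀ {Y : Type} [TopologicalSpace Y] [CompactSpace Y] (F : ℕ × unitInterval → Y),
        ∃ p, Tendsto F g (𝓝 p) := by
      intro Y _ _ F
      obtain ⟨p, -, hp⟩ := isCompact_univ.ultrafilter_le_nhds (g.map F) (by simp)
      exact ⟨p, hp⟩
    obtain ⟨p, hp⟩ := hlim (fun q : ℕ × unitInterval => Φ q.1 q.2)
    obtain ⟨p', hp'⟩ := hlim (fun q : ℕ × unitInterval => Ψ q.2)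
    obtain ⟨t, ht⟩ := hlim (fun q : ℕ × unitInterval => q.2)
    have hfst : Tendsto (fun q : ℕ × unitInterval => q.1) g atTop := tendsto_fst.mono_left hg
    have ht' : Tendsto (fun q : ℕ × unitInterval => (q.2 : ℝ)) g (𝓝 (t : ℝ)) :=
      (continuous_subtype_val.tendsto t).comp ht
    have heq : p = p' := by
      apply invLim_ext_ge m
      intro k hk
      have hc := proj_cont s k
      have e1 : proj s k p = proj s k x + t * (proj s k y - proj s k x) := by
        have l1 : Tendsto (fun q : ℕ × unitInterval => proj s k (Φ q.1 q.2)) g (𝓝 (proj s k p)) :=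
          (hc.tendsto p).comp hp
        have lx : Tendsto (fun q : ℕ × unitInterval => proj s k (xn q.1)) g (𝓝 (proj s k x)) :=
          ((hc.tendsto x).comp hxn).comp hfst
        have ly : Tendsto (fun q : ℕ × unitInterval => proj s k (yn q.1)) g (𝓝 (proj s k y)) :=
          ((hc.tendsto y).comp hyn).comp hfst
        refine tendsto_nhds_unique l1 ((lx.add (ht'.mul (ly.sub lx))).congr' ?_)
        filter_upwards [hfst.eventually (eventually_ge_atTop N)] with q hq
        exact ((hΦ q.1 hq).2 q.2 k hk).symm
      have e2 : proj s k p' = proj s k x + t * (proj s k y - proj s k x) := by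
        have l1 : Tendsto (fun q : ℕ × unitInterval => proj s k (Ψ q.2)) g (𝓝 (proj s k p')) :=
          (hc.tendsto p').comp hp'
        refine tendsto_nhds_unique l1
          ((tendsto_const_nhds.add (ht'.mul tendsto_const_nhds)).congr fun q => ?_)
        exact (hΨ2 q.2 k hk).symm
      exact e1.trans e2.symm
    subst heq
    exact ⟨p, hp, hp'⟩
  exact @hausdorff_aux _ (TopologicalSpace.metrizableSpaceMetric _) An A Φ Ψ N
    (fun n h => (hΦ n h).1) hΨ key
end
end

section
/- Let 0̄ = (0, 0, 0, …) ∈ K and let C_0 be the composant of 0̄ in K. Then for every homeomorphism h : K → K, one has h(C_0) = C_0. -/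
open Set Filter Topology Function

noncomputable section

theorem nested_preconn {X : Type*} [TopologicalSpace X] [T2Space X] (E : ℕ → Set X)
    (hA : Antitone E) (hc : ∀ n, IsCompact (E n)) (hp : ∀ n, IsPreconnected (E n)) :
    IsPreconnected (⋂ n, E n) := by
  have hcl : ∀ n, IsClosed (E n) := fun n => (hc n).isClosed
  have hSc : IsCompact (⋂ n, E n) := (hc 0).of_isClosed_subset (isClosed_iInter hcl) (iInter_subset _ 0)
  rw [isPreconnected_closed_iff]
  intro t t' ht ht' hsub h1 h2
  by_contra hne
  have hdisj : Disjoint ((⋂ n, E n) ∩ t) ((⋂ n, E n) ∩ t') := by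
    rw [Set.disjoint_left]
    rintro x ⟨hx, hxt⟩ ⟨_, hxt'⟩
    exact hne ⟨x, hx, hxt, hxt'⟩
  obtain ⟨U, V, hU, hV, hUs, hVs, hUV⟩ :=
    SeparatedNhds.of_isCompact_isCompact (hSc.inter_right ht) (hSc.inter_right ht') hdisj
  obtain ⟨n, hn⟩ := exists_subset_nhds_of_isCompact' (V := E) (U := U ∪ V)
    (directed_of_isDirected_le hA) hc hcl (by
      intro x hx
      refine (hU.union hV).mem_nhds ?_
      rcases hsub hx with h | h
      · exact Or.inl (hUs ⟨hx, h⟩)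
      · exact Or.inr (hVs ⟨hx, h⟩))
  obtain ⟨x, hx⟩ := h1
  obtain ⟨y, hy⟩ := h2
  obtain ⟨z, _, hzU, hzV⟩ := hp n U V hU hV hn ⟨x, mem_iInter.1 hx.1 n, hUs hx⟩
    ⟨y, mem_iInter.1 hy.1 n, hVs hy⟩
  exact Set.disjoint_left.1 hUV hzU hzV

theorem invlim_preconn (T : ℝ → ℝ) (hT : Continuous T) (a : ℕ → ℝ) (b : ℝ)
    (hm : ∀ n, ∀ x ∈ Icc (a (n+1)) b, T x ∈ Icc (a n) b) :
    IsPreconnected {z : ℕ → ℝ | (∀ n, z n ∈ Icc (a n) b) ∧ ∀ n, z n = T (z (n+1))} := by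
  let P : Set (ℕ → ℝ) := univ.pi fun n => Icc (a n) b
  have hPc : IsCompact P := isCompact_univ_pi fun n => isCompact_Icc
  have hPp : IsPreconnected P := isPreconnected_univ_pi fun n => isPreconnected_Icc
  let E : ℕ → Set (ℕ → ℝ) := fun N => P ∩ {z | ∀ n < N, z n = T (z (n+1))}
  have hE : {z : ℕ → ℝ | (∀ n, z n ∈ Icc (a n) b) ∧ ∀ n, z n = T (z (n+1))} = ⋂ N, E N := by
    ext z
    simp only [E, P, mem_setOf_eq, mem_iInter, mem_inter_iff, mem_univ_pi]
    constructor
    · rintro ⟨h1, h2⟩ N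
      exact ⟨h1, fun n _ => h2 n⟩
    · intro h
      exact ⟨(h 0).1, fun n => (h (n+1)).2 n (Nat.lt_succ_self n)⟩
  rw [hE]
  have hit : ∀ k n x, x ∈ Icc (a (n+k)) b → T^[k] x ∈ Icc (a n) b := by
    intro k
    induction k with
    | zero => intro n x hx; simpa using hx
    | succ k ih =>
      intro n x hx
      rw [Function.iterate_succ_apply]
      exact ih n _ (hm (n+k) x hx)
  apply nested_preconn
  · intro M N hMN z hz
    exact ⟨hz.1, fun n hn => hz.2 n (lt_of_lt_of_le hn hMN)⟩
  · intro N
    apply hPc.inter_right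
    have : {z : ℕ → ℝ | ∀ n < N, z n = T (z (n+1))} = ⋂ n, ⋂ (_ : n < N), {z | z n = T (z (n+1))} := by
      ext z; simp
    rw [this]
    exact isClosed_iInter fun n => isClosed_iInter fun _ =>
      isClosed_eq (continuous_apply n) (hT.comp (continuous_apply (n+1)))
  · intro N
    have himg : E N = (fun (w : ℕ → ℝ) (n : ℕ) => if n ≤ N then T^[N-n] (w N) else w n) '' P := by
      ext z
      constructor
      · rintro ⟨hzP, hz⟩
        refine ⟨z, hzP, ?_⟩
        have key : ∀ k, k ≤ N → T^[k] (z N) = z (N - k) := by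
          intro k
          induction k with
          | zero => intro _; simp
          | succ k ih =>
            intro hk
            rw [Function.iterate_succ_apply', ih (by omega), hz (N-(k+1)) (by omega)]
            congr 2; omega
        funext n
        by_cases hn : n ≤ N
        · simp only [hn, if_true]
          rw [key _ (by omega)]
          congr 1; omega
        · simp [hn]
      · rintro ⟨w, hw, rfl⟩
        have hw' : ∀ n, w n ∈ Icc (a n) b := fun n => hw n (mem_univ n)
        refine ⟨?_, ?_⟩
        · intro n _
          by_cases hn : n ≤ N
          · simp only [hn, if_true]
            apply hit
            rw [Nat.add_sub_cancel' hn]; exact hw' N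
          · simp only [hn, if_false]; exact hw' n
        · intro n hn
          have h1 : n ≤ N := by omega
          have h2 : n + 1 ≤ N := by omega
          simp only [h1, h2, if_true]
          rw [← Function.iterate_succ_apply' T]
          congr 2; omega
    rw [himg]
    apply hPp.image
    apply Continuous.continuousOn
    apply continuous_pi
    intro n
    by_cases hn : n ≤ N
    · simp only [hn, if_true]
      exact (hT.iterate _).comp (continuous_apply N)
    · simp only [hn, if_false]
      exact continuous_apply n

theorem tent_cont (s : ℝ) : Continuous (tent s) := by unfold tent; fun_prop

theorem tent_le_half {s : ℝ} (hs : 0 < s) (x : ℝ) : tent s x ≤ s / 2 := by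
  unfold tent
  rcases le_total x (1/2) with h | h
  · exact (min_le_left _ _).trans (by nlinarith)
  · exact (min_le_right _ _).trans (by nlinarith)

theorem tent_of_le {s : ℝ} (hs : 0 < s) {x : ℝ} (h : x ≤ 1/2) : tent s x = s * x := by
  unfold tent
  exact min_eq_left (by nlinarith)

theorem tent_of_ge {s : ℝ} (hs : 0 < s) {x : ℝ} (h : 1/2 ≤ x) : tent s x = s * (1 - x) := by
  unfold tent
  exact min_eq_right (by nlinarith)

theorem coord_le {s : ℝ} (hs : 0 < s) (x : invLim s) (n : ℕ) : (x : ℕ → ℝ) n ≤ s / 2 := by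
  rw [x.2.2 n]; exact tent_le_half hs _

theorem isClosed_invLim (s : ℝ) : IsClosed (invLim s) := by
  have : invLim s = (⋂ n, {x : ℕ → ℝ | x n ∈ Icc (0:ℝ) 1}) ∩ ⋂ n, {x | x n = tent s (x (n+1))} := by
    ext x; simp [invLim]
  rw [this]
  refine (isClosed_iInter fun n => isClosed_Icc.preimage (continuous_apply n)).inter
    (isClosed_iInter fun n => isClosed_eq (continuous_apply n) ((tent_cont s).comp (continuous_apply (n+1))))

theorem compact_invLim (s : ℝ) : IsCompact (invLim s) := by
  refine (isCompact_univ_pi (fun _ : ℕ => isCompact_Icc (a := (0:ℝ)) (b := 1))).of_isClosed_subset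
    (isClosed_invLim s) ?_
  intro x hx n _
  exact hx.1 n

theorem eq_below {s : ℝ} (x y : invLim s) (m : ℕ) (h : (x : ℕ → ℝ) m = (y : ℕ → ℝ) m) :
    ∀ k, (x : ℕ → ℝ) (m - k) = (y : ℕ → ℝ) (m - k) := by
  intro k
  induction k with
  | zero => simpa using h
  | succ k ih =>
    by_cases hk : k + 1 ≤ m
    · rw [x.2.2 (m-(k+1)), y.2.2 (m-(k+1))]
      have : m - (k+1) + 1 = m - k := by omega
      rw [this, ih]
    · have : m - (k+1) = m - k := by omega
      rw [this, ih]

/-- A subcontinuum through `0̄` and a point of the core is everything. -/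
theorem full_of_mem {s : ℝ} (hs1 : Real.sqrt 2 < s) (A : Set (invLim s))
    (hc : IsCompact A) (hp : IsPreconnected A) (h0 : zeroPt s hs1 ∈ A) (q : invLim s) (hq : q ∈ A)
    (hbig : ∀ m, ∃ n, m ≤ n ∧ 1/2 ≤ (q : ℕ → ℝ) (n+1)) : A = univ := by
  have hs : 0 < s := lt_of_le_of_lt (Real.sqrt_nonneg 2) hs1
  rw [eq_univ_iff_forall]
  intro y
  have key : ∀ m, ∃ a ∈ A, ∀ i ≤ m, (a : ℕ → ℝ) i = (y : ℕ → ℝ) i := by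
    intro m
    obtain ⟨n, hmn, hn⟩ := hbig m
    have hpi : IsPreconnected ((fun x : invLim s => (x : ℕ → ℝ) (n+1)) '' A) :=
      hp.image _ (((continuous_apply (n+1)).comp continuous_subtype_val).continuousOn)
    have hyn := coord_le hs y n
    have hyn0 := (y.2.1 n).1
    have ht : (y : ℕ → ℝ) n / s ≤ 1/2 := by
      rw [div_le_iff₀ hs]; linarith
    obtain ⟨a, ha, hat⟩ := hpi.ordConnected.out (x := 0) ⟨_, h0, rfl⟩ ⟨q, hq, rfl⟩
      (show (y : ℕ → ℝ) n / s ∈ Icc _ _ from ⟨by positivity, ht.trans hn⟩)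
    refine ⟨a, ha, fun i hi => ?_⟩
    have han : (a : ℕ → ℝ) n = (y : ℕ → ℝ) n := by
      rw [a.2.2 n]
      simp only at hat
      rw [hat, tent_of_le hs ht]
      field_simp
    have := eq_below a y n han (n - i)
    rwa [show n - (n - i) = i by omega] at this
  choose a haA ha using key
  refine hc.isClosed.mem_of_tendsto (b := atTop) (f := a) ?_ (Eventually.of_forall haA)
  rw [tendsto_subtype_rng, tendsto_pi_nhds]
  intro i
  apply tendsto_const_nhds.congr'
  filter_upwards [eventually_ge_atTop i] with m hm
  exact (ha m i hm).symm

theorem pos_of_ne {s : ℝ} (hs1 : Real.sqrt 2 < s) (hs2 : s < 2) (x : invLim s)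
    (hx : x ≠ zeroPt s hs1) : 0 < (x : ℕ → ℝ) 0 := by
  have hs : 0 < s := lt_of_le_of_lt (Real.sqrt_nonneg 2) hs1
  rcases (x.2.1 0).1.lt_or_eq with h | h
  · exact h
  exfalso
  apply hx
  apply Subtype.ext
  funext n
  change (x : ℕ → ℝ) n = 0
  induction n with
  | zero => exact h.symm
  | succ n ih =>
    have h1 := x.2.2 n
    have h2 := coord_le hs x (n+1)
    rw [ih] at h1
    rcases le_total ((x : ℕ → ℝ) (n+1)) (1/2) with hc | hc
    · rw [tent_of_le hs hc] at h1
      rcases mul_eq_zero.1 h1.symm with h3 | h3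
      · linarith
      · exact h3
    · rw [tent_of_ge hs hc] at h1
      nlinarith

theorem coord_ge {s : ℝ} (hs : 0 < s) (x : invLim s) (a : ℝ) (ha : a ≤ (x : ℕ → ℝ) 0) (n : ℕ) :
    a / s ^ n ≤ (x : ℕ → ℝ) n := by
  induction n with
  | zero => simpa using ha
  | succ n ih =>
    have h1 : (x : ℕ → ℝ) n ≤ s * (x : ℕ → ℝ) (n+1) := by
      rw [x.2.2 n]; exact min_le_left _ _
    have h2 : a / s^(n+1) = (a / s^n) / s := by rw [pow_succ]; field_simp
    rw [h2, div_le_iff₀ hs]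
    linarith

theorem mem_comp_of_ne {s : ℝ} (hs1 : Real.sqrt 2 < s) (hs2 : s < 2) (x y : invLim s)
    (hx : x ≠ zeroPt s hs1) (hy : y ≠ zeroPt s hs1) : y ∈ composant x := by
  have hs : 0 < s := lt_of_le_of_lt (Real.sqrt_nonneg 2) hs1
  have hs1' : 1 < s := by
    refine lt_of_le_of_lt ?_ hs1
    rw [Real.one_le_sqrt]; norm_num
  have hx0 := pos_of_ne hs1 hs2 x hx
  have hy0 := pos_of_ne hs1 hs2 y hy
  have he : 0 < s * (1 - s/2) := mul_pos hs (by linarith)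
  obtain ⟨a, ha0, hax, hay, hae⟩ : ∃ a : ℝ, 0 < a ∧ a ≤ (x : ℕ → ℝ) 0 ∧ a ≤ (y : ℕ → ℝ) 0 ∧
      a ≤ s * (1 - s/2) :=
    ⟨min (min ((x : ℕ → ℝ) 0) ((y : ℕ → ℝ) 0)) (s * (1 - s/2)), by positivity,
      (min_le_left _ _).trans (min_le_left _ _), (min_le_left _ _).trans (min_le_right _ _),
      min_le_right _ _⟩
  let B : Set (ℕ → ℝ) :=
    {z | (∀ n, z n ∈ Icc ((fun n : ℕ => a / s^n) n) (s/2)) ∧ ∀ n, z n = tent s (z (n+1))}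
  have hB : IsPreconnected B := by
    apply invlim_preconn (tent s) (tent_cont s)
    rintro n z ⟨hz1, hz2⟩
    refine ⟨?_, tent_le_half hs z⟩
    rcases le_total z (1/2) with hc | hc
    · rw [tent_of_le hs hc]
      have h2 : a / s^(n+1) = (a / s^n) / s := by rw [pow_succ]; field_simp
      simp only [h2] at hz1
      rw [div_le_iff₀ hs] at hz1
      linarith
    · rw [tent_of_ge hs hc]
      have h3 : a / s^n ≤ a := div_le_self ha0.le (one_le_pow₀ hs1'.le)
      have h4 : s * (1 - s/2) ≤ s * (1 - z) := mul_le_mul_of_nonneg_left (by linarith) hs.le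
      linarith
  have hBK : B ⊆ invLim s := by
    rintro z ⟨h1, h2⟩
    refine ⟨fun n => ⟨le_trans (by positivity) (h1 n).1, (h1 n).2.trans (by linarith)⟩, h2⟩
  let A : Set (invLim s) := Subtype.val ⁻¹' B
  have hAB : Subtype.val '' A = B := by
    rw [Subtype.image_preimage_coe]
    exact inter_eq_right.2 hBK
  have hxA : x ∈ A := ⟨fun n => ⟨coord_ge hs x a hax n, coord_le hs x n⟩, x.2.2⟩
  have hyA : y ∈ A := ⟨fun n => ⟨coord_ge hs y a hay n, coord_le hs y n⟩, y.2.2⟩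
  have hBcl : IsClosed B := by
    have : B = (⋂ n, {z : ℕ → ℝ | z n ∈ Icc (a / s^n) (s/2)}) ∩ ⋂ n, {z | z n = tent s (z (n+1))} := by
      ext z; simp [B]
    rw [this]
    exact (isClosed_iInter fun n => isClosed_Icc.preimage (continuous_apply n)).inter
      (isClosed_iInter fun n => isClosed_eq (continuous_apply n)
        ((tent_cont s).comp (continuous_apply (n+1))))
  haveI : CompactSpace (invLim s) := isCompact_iff_compactSpace.1 (compact_invLim s)
  refine ⟨A, (hBcl.preimage continuous_subtype_val).isCompact, ⟨⟨x, hxA⟩, ?_⟩, ?_, hxA, hyA⟩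
  · rw [← Topology.IsInducing.subtypeVal.isPreconnected_image, hAB]
    exact hB
  · intro hu
    have h0 : zeroPt s hs1 ∈ A := by rw [hu]; trivial
    have h1 := (h0.1 0).1
    have h2 : ((zeroPt s hs1 : invLim s) : ℕ → ℝ) 0 = 0 := rfl
    rw [h2] at h1
    simp at h1
    linarith

theorem image_composant_subset {X : Type*} [TopologicalSpace X] (h : X ≃ₜ X) (x : X) :
    h '' composant x ⊆ composant (h x) := by
  rintro _ ⟨y, ⟨A, hc, hp, hne, hx, hy⟩, rfl⟩
  refine ⟨h '' A, hc.image h.continuous, hp.image h h.continuous.continuousOn, ?_,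
    mem_image_of_mem h hx, mem_image_of_mem h hy⟩
  intro hu
  apply hne
  rw [eq_univ_iff_forall]
  intro z
  have : h z ∈ h '' A := by rw [hu]; trivial
  exact (h.injective.mem_set_image).1 this

theorem image_composant {X : Type*} [TopologicalSpace X] (h : X ≃ₜ X) (x : X) :
    h '' composant x = composant (h x) := by
  apply (image_composant_subset h x).antisymm
  intro y hy
  have := image_composant_subset h.symm (h x) (mem_image_of_mem _ hy)
  rw [h.symm_apply_apply] at this
  exact ⟨_, this, h.apply_symm_apply y⟩

/-- every homeomorphism of `K` maps the composant of the endpoint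
`0̄ = (0,0,0,…)` onto itself. -/
theorem statement11 (s : ℝ) (hs1 : Real.sqrt 2 < s) (hs2 : s < 2)
    (hnr : (1 : ℝ) / 2 ∉ omegaSet (tent s) (1 / 2))
    (h : invLim s ≃ₜ invLim s) :
    ⇑h '' composant (zeroPt s hs1) = composant (zeroPt s hs1) := by
  have hs : 0 < s := lt_of_le_of_lt (Real.sqrt_nonneg 2) hs1
  have hs1' : 1 < s := by
    refine lt_of_le_of_lt ?_ hs1
    rw [Real.one_le_sqrt]; norm_num
  have hd : 0 < 1 + s^2 := by positivity
  -- the periodic orbit of period two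
  obtain ⟨b, c, hb0, hb, hc, hc1, hbc, hcb⟩ : ∃ b c : ℝ, 0 ≤ b ∧ b < 1/2 ∧ 1/2 ≤ c ∧ c ≤ 1 ∧
      tent s b = c ∧ tent s c = b := by
    have h1 : s / (1 + s^2) < 1/2 := by rw [div_lt_iff₀ hd]; nlinarith
    have h2 : 1/2 ≤ s^2 / (1 + s^2) := by rw [le_div_iff₀ hd]; nlinarith
    refine ⟨s / (1 + s^2), s^2 / (1 + s^2), by positivity, h1, h2, ?_, ?_, ?_⟩
    · rw [div_le_iff₀ hd]; linarith
    · rw [tent_of_le hs h1.le]; ring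
    · rw [tent_of_ge hs h2]; field_simp; ring
  let p : invLim s := ⟨fun n => if Even n then b else c, by
    intro n
    by_cases hn : Even n <;> simp only [hn, if_true, if_false] <;> constructor <;> linarith, by
    intro n
    by_cases hn : Even n <;> simp [hn, Nat.even_add_one, hbc, hcb]⟩
  let q : invLim s := ⟨fun n => if Even n then c else b, by
    intro n
    by_cases hn : Even n <;> simp only [hn, if_true, if_false] <;> constructor <;> linarith, by
    intro n
    by_cases hn : Even n <;> simp [hn, Nat.even_add_one, hbc, hcb]⟩
  have hpq : p ≠ q := by
    intro e
    have := congrArg (fun z : invLim s => (z : ℕ → ℝ) 0) e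
    simp [p, q] at this
    linarith
  have hp : p ∉ composant (zeroPt s hs1) := by
    rintro ⟨A, hAc, hAp, hne, h0, hpA⟩
    refine hne (full_of_mem hs1 A hAc hAp.isPreconnected h0 p hpA fun m => ⟨2*m, by omega, ?_⟩)
    have : ¬ Even (2*m+1) := by simp
    simp only [p, this, if_false]
    exact hc
  have hq : q ∉ composant (zeroPt s hs1) := by
    rintro ⟨A, hAc, hAp, hne, h0, hqA⟩
    refine hne (full_of_mem hs1 A hAc hAp.isPreconnected h0 q hqA fun m => ⟨2*m+1, by omega, ?_⟩)
    have : Even (2*m+1+1) := ⟨m+1, by ring⟩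
    simp only [q, this, if_true]
    exact hc
  rw [image_composant]
  by_cases hz : h (zeroPt s hs1) = zeroPt s hs1
  · rw [hz]
  · exfalso
    have key : ∀ r, r ∉ composant (zeroPt s hs1) → h r = zeroPt s hs1 := by
      intro r hr
      by_contra hne
      have := mem_comp_of_ne hs1 hs2 _ _ hz hne
      rw [← image_composant] at this
      exact hr (h.injective.mem_set_image.1 this)
    exact hpq (h.injective ((key p hp).trans (key q hq).symm))
end
end

section
/- Let A be an arc in K with endpoints x̄ and ȳ, and let n ∈ ℕ be such that π_n restricted to A is injective. Then for every m ≥ n, π_m restricted to A is injective, s^m · |π_m(x̄) − π_m(ȳ)| = s^n · |π_n(x̄) − π_n(ȳ)|, and s^m · diam(π_m(A)) = s^n · diam(π_n(A)). In particular, the d̄-length ℓ(A) = s^m · diam(π_m(A)) does not depend on the choice of m with π_m|_A injective. -/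
open Set Filter Topology Function

noncomputable section

theorem tent_step (s : ℝ) (hs : 0 < s) (A : Set (invLim s)) (hA : IsPreconnected A)
    (n : ℕ) (hn : InjOn (proj s n) A) (a b : invLim s) (ha : a ∈ A) (hb : b ∈ A) :
    |proj s n a - proj s n b| = s * |proj s (n+1) a - proj s (n+1) b| := by
  have hc : Continuous (proj s (n+1)) := (continuous_apply (n+1)).comp continuous_subtype_val
  have hI : (proj s (n+1) '' A).OrdConnected := (hA.image _ hc.continuousOn).ordConnected
  have hT : ∀ c : invLim s, proj s n c = tent s (proj s (n+1) c) := fun c => c.2.2 n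
  have hinj : ∀ u ∈ proj s (n+1) '' A, ∀ v ∈ proj s (n+1) '' A,
      tent s u = tent s v → u = v := by
    rintro _ ⟨c, hcA, rfl⟩ _ ⟨d, hdA, rfl⟩ h
    rw [← hT, ← hT] at h
    rw [hn hcA hdA h]
  have key : ∀ u ∈ proj s (n+1) '' A, ∀ v ∈ proj s (n+1) '' A, u < 1/2 → 1/2 < v → False := by
    intro u hu v hv h1 h2
    obtain ⟨e, he, he1, he2⟩ : ∃ e : ℝ, 0 < e ∧ e ≤ 1/2 - u ∧ e ≤ v - 1/2 :=
      ⟨min (1/2 - u) (v - 1/2), lt_min (by linarith) (by linarith), min_le_left _ _,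
        min_le_right _ _⟩
    have h3 := hinj (1/2 - e) (hI.out hu hv ⟨by linarith, by linarith⟩)
      (1/2 + e) (hI.out hu hv ⟨by linarith, by linarith⟩) (by
        unfold tent
        rw [min_comm]
        congr 2 <;> ring)
    linarith
  have tl : ∀ u : ℝ, u ≤ 1/2 → tent s u = s * u := fun u hu =>
    min_eq_left (mul_le_mul_of_nonneg_left (by linarith) hs.le)
  have tr : ∀ u : ℝ, 1/2 ≤ u → tent s u = s * (1 - u) := fun u hu =>
    min_eq_right (mul_le_mul_of_nonneg_left (by linarith) hs.le)
  rw [hT a, hT b]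
  have ha' := mem_image_of_mem (proj s (n+1)) ha
  have hb' := mem_image_of_mem (proj s (n+1)) hb
  generalize proj s (n+1) a = u at *
  generalize proj s (n+1) b = v at *
  have hl : u ≤ 1/2 → v ≤ 1/2 → |tent s u - tent s v| = s * |u - v| := by
    intro h1 h2
    rw [tl u h1, tl v h2, ← mul_sub, abs_mul, abs_of_pos hs]
  have hr : 1/2 ≤ u → 1/2 ≤ v → |tent s u - tent s v| = s * |u - v| := by
    intro h1 h2
    rw [tr u h1, tr v h2, ← mul_sub, abs_mul, abs_of_pos hs, abs_sub_comm u v]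
    congr 2
    ring
  rcases lt_trichotomy u (1/2) with h1 | h1 | h1
  · exact hl h1.le (not_lt.1 fun h => key u ha' v hb' h1 h)
  · rcases le_total v (1/2) with h2 | h2
    · exact hl h1.le h2
    · exact hr h1.ge h2
  · exact hr h1.le (not_lt.1 fun h => key v hb' u ha' h h1)

theorem tent_all (s : ℝ) (hs : 0 < s) (A : Set (invLim s)) (hA : IsPreconnected A)
    (n : ℕ) (hn : InjOn (proj s n) A) (m : ℕ) (hm : n ≤ m) :
    InjOn (proj s m) A ∧ ∀ a ∈ A, ∀ b ∈ A,
      s ^ m * |proj s m a - proj s m b| = s ^ n * |proj s n a - proj s n b| := by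
  induction m, hm using Nat.le_induction with
  | base => exact ⟨hn, fun _ _ _ _ => rfl⟩
  | succ m hm ih =>
    refine ⟨fun a ha b hb h => ih.1 ha hb ?_, fun a ha b hb => ?_⟩
    · have := tent_step s hs A hA m ih.1 a b ha hb
      rw [h, sub_self, abs_zero, mul_zero, abs_eq_zero, sub_eq_zero] at this
      exact this
    · rw [← ih.2 a ha b hb, tent_step s hs A hA m ih.1 a b ha hb]
      ring

theorem diam_le_aux (s : ℝ) (hs : 0 < s) (A : Set (invLim s)) (m n : ℕ)
    (h : ∀ a ∈ A, ∀ b ∈ A,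
      s ^ m * |proj s m a - proj s m b| = s ^ n * |proj s n a - proj s n b|) :
    s ^ m * Metric.diam (proj s m '' A) ≤ s ^ n * Metric.diam (proj s n '' A) := by
  have hp : 0 < s ^ m := pow_pos hs m
  have hq : 0 < s ^ n := pow_pos hs n
  have hbd : Bornology.IsBounded (proj s n '' A) := by
    refine (Metric.isBounded_Icc (0:ℝ) 1).subset ?_
    rintro _ ⟨c, _, rfl⟩
    exact c.2.1 n
  rw [mul_comm, ← le_div_iff₀ hp]
  refine Metric.diam_le_of_forall_dist_le
    (div_nonneg (mul_nonneg hq.le Metric.diam_nonneg) hp.le) ?_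
  rintro _ ⟨a, ha, rfl⟩ _ ⟨b, hb, rfl⟩
  rw [le_div_iff₀ hp, mul_comm, Real.dist_eq, h a ha b hb, ← Real.dist_eq]
  exact mul_le_mul_of_nonneg_left
    (Metric.dist_le_diam_of_mem hbd (mem_image_of_mem _ ha) (mem_image_of_mem _ hb)) hq.le

/-- if `π_n` is injective on an arc `A` with endpoints `x̄, ȳ`, then so is `π_m`
for every `m ≥ n`, and the quantities `s^m·|π_m(x̄) − π_m(ȳ)|` and `s^m·diam(π_m(A))` do not
depend on `m`; in particular the `d̄`-length of `A` is well defined. -/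
theorem statement13 (s : ℝ) (hs1 : Real.sqrt 2 < s) (hs2 : s < 2)
    (hnr : (1 : ℝ) / 2 ∉ omegaSet (tent s) (1 / 2))
    (A : Set (invLim s)) (x y : invLim s) (hA : IsArcWith A x y)
    (n : ℕ) (hn : InjOn (proj s n) A) :
    (∀ m : ℕ, n ≤ m → InjOn (proj s m) A ∧
      s ^ m * |proj s m x - proj s m y| = s ^ n * |proj s n x - proj s n y| ∧
      s ^ m * Metric.diam (proj s m '' A) = s ^ n * Metric.diam (proj s n '' A)) ∧
    ∀ m m' : ℕ, InjOn (proj s m) A → InjOn (proj s m') A →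
      s ^ m * Metric.diam (proj s m '' A) = s ^ m' * Metric.diam (proj s m' '' A) := by
  have hs : 0 < s := lt_of_le_of_lt (Real.sqrt_nonneg 2) hs1
  obtain ⟨f, hf, rfl, rfl, rfl⟩ := hA
  have hP : IsPreconnected (range f) := isPreconnected_range hf.continuous
  have hD : ∀ n m : ℕ, InjOn (proj s n) (range f) → n ≤ m →
      s ^ m * Metric.diam (proj s m '' range f) = s ^ n * Metric.diam (proj s n '' range f) := by
    intro n m hn hm
    have h := (tent_all s hs _ hP n hn m hm).2
    exact le_antisymm (diam_le_aux s hs _ m n h)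
      (diam_le_aux s hs _ n m fun a ha b hb => (h a ha b hb).symm)
  refine ⟨fun m hm => ?_, fun m m' h h' => ?_⟩
  · have h := tent_all s hs _ hP n hn m hm
    exact ⟨h.1, h.2 _ (mem_range_self _) _ (mem_range_self _), hD n m hn hm⟩
  · rcases le_total m m' with hm | hm
    · exact (hD m m' h hm).symm
    · exact hD m' m h' hm
end
end
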